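/- Let n > 3, s ≥ 1, let Λ = (λ_1,…,λ_n), λ_j ∈ ℂ, be weakly hyperbolic, and let c_1,…,c_s, d_1,…,d_n be positive real numbers. For X = (w,z) ∈ Z_{(Λ,n,s)} define the real-valued 1-form α_X(a,b) = i(∑_{r=1}^s c_r (w_r conj(a_r) − conj(w_r) a_r) + ∑_{j=1}^n d_j (z_j conj(b_j) − conj(z_j) b_j)). Then for every X ∈ Z_{(Λ,n,s)}, α_X is nontrivial on the tangent space T_X: there exists v ∈ T_X with α_X(v) ≠ 0. -/

import Mathlib

open scoped BigOperators

/-- `Λ` is weakly hyperbolic (`k = 2`). -/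
def WeaklyHyperbolicC {n : ℕ} (Λ : Fin n → ℂ) : Prop :=
  ∀ J : Finset (Fin n), J.card ≤ 2 → (0 : ℂ) ∉ convexHull ℝ (Λ '' ↑J)

/-- The manifold `Z_{(Λ,n,s)} ⊆ ℂ^s × ℂ^n` cut out by
`F_s(w,z) = ∑ w_r² + ∑ λ_j |z_j|² = 0` and `ρ_s(w,z) = ∑ |w_r|² + ∑ |z_j|² = 1`. -/
def ZLS (s : ℕ) {n : ℕ} (Λ : Fin n → ℂ) : Set ((Fin s → ℂ) × (Fin n → ℂ)) :=
  {X | (∑ r, X.1 r ^ 2) + (∑ j, Λ j * (Complex.normSq (X.2 j) : ℂ)) = 0 ∧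
       (∑ r, Complex.normSq (X.1 r)) + (∑ j, Complex.normSq (X.2 j)) = 1}

/-- The tangent space of `Z_{(Λ,n,s)}` at `X = (w,z)`: all `v = (a,b) ∈ ℂ^s × ℂ^n` with
`∑ 2 w_r a_r + ∑ λ_j (conj(z_j) b_j + z_j conj(b_j)) = 0` and
`Re(∑ conj(w_r) a_r + ∑ conj(z_j) b_j) = 0`. -/
def TangentAt (s : ℕ) {n : ℕ} (Λ : Fin n → ℂ)
    (X v : (Fin s → ℂ) × (Fin n → ℂ)) : Prop :=
  ((∑ r, 2 * X.1 r * v.1 r) +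
      (∑ j, Λ j * ((starRingEnd ℂ) (X.2 j) * v.2 j + X.2 j * (starRingEnd ℂ) (v.2 j))) = 0) ∧
  ((∑ r, (starRingEnd ℂ) (X.1 r) * v.1 r) + (∑ j, (starRingEnd ℂ) (X.2 j) * v.2 j)).re = 0

/-- The weighted `1`-form
`α_X(a,b) = i(∑ c_r (w_r conj(a_r) − conj(w_r) a_r) + ∑ d_j (z_j conj(b_j) − conj(z_j) b_j))`
is nontrivial on the tangent space at every point `X ∈ Z_{(Λ,n,s)}`. -/
theorem alpha_nontrivial {n s : ℕ} (hn : 3 < n) (hs : 1 ≤ s)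
    (Λ : Fin n → ℂ) (hΛ : WeaklyHyperbolicC Λ)
    (c : Fin s → ℝ) (d : Fin n → ℝ) (hc : ∀ r, 0 < c r) (hd : ∀ j, 0 < d j)
    (X : (Fin s → ℂ) × (Fin n → ℂ)) (hX : X ∈ ZLS s Λ) :
    ∃ v : (Fin s → ℂ) × (Fin n → ℂ), TangentAt s Λ X v ∧
      Complex.I *
        ((∑ r, (c r : ℂ) * (X.1 r * (starRingEnd ℂ) (v.1 r) - (starRingEnd ℂ) (X.1 r) * v.1 r)) +
         (∑ j, (d j : ℂ) * (X.2 j * (starRingEnd ℂ) (v.2 j) - (starRingEnd ℂ) (X.2 j) * v.2 j)))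
        ≠ 0 := by
  obtain ⟨w, z⟩ := X
  obtain ⟨hF, hρ⟩ := hX
  simp only at hF hρ
  have rotate_form (k : ℝ) (u : ℂ) :
      (k : ℂ) * (u * (starRingEnd ℂ) (Complex.I * u) - (starRingEnd ℂ) u * (Complex.I * u)) =
        -2 * Complex.I * ((k * Complex.normSq u : ℝ) : ℂ) := by
    push_cast
    rw [Complex.normSq_eq_conj_mul_self, map_mul, Complex.conj_I]
    ring
  by_cases hz : ∃ j, z j ≠ 0
  · -- rotate a single nonzero coordinate of `z`
    obtain ⟨j, hj⟩ := hz
    refine ⟨(0, Pi.single j (Complex.I * z j)), ⟨?_, ?_⟩, ?_⟩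
    · simp only [Pi.zero_apply, mul_zero, Finset.sum_const_zero, zero_add]
      rw [Finset.sum_eq_single j (fun i _ hi => by simp [hi]) (by simp)]
      simp only [Pi.single_eq_same, map_mul, Complex.conj_I]
      ring
    · simp only [Pi.zero_apply, mul_zero, Finset.sum_const_zero, zero_add]
      rw [Finset.sum_eq_single j (fun i _ hi => by simp [hi]) (by simp)]
      simp only [Pi.single_eq_same, Complex.mul_re, Complex.mul_im, Complex.conj_re,
        Complex.conj_im, Complex.I_re, Complex.I_im]
      ring
    · simp only [Pi.zero_apply, map_zero, mul_zero, sub_zero, Finset.sum_const_zero, zero_add]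
      rw [Finset.sum_eq_single j (fun i _ hi => by simp [hi]) (by simp), Pi.single_eq_same,
        rotate_form]
      simp [(hd j).ne', hj]
  · -- here `z = 0`, so `∑ w_r² = 0` and rotating all of `w` is tangent
    push Not at hz
    simp only [hz, map_zero, Complex.ofReal_zero, mul_zero, Finset.sum_const_zero,
      add_zero] at hF hρ
    refine ⟨(fun r => Complex.I * w r, 0), ⟨?_, ?_⟩, ?_⟩
    · simp only [hz, Pi.zero_apply, map_zero, mul_zero, add_zero, Finset.sum_const_zero]
      calc ∑ r, 2 * w r * (Complex.I * w r) = 2 * Complex.I * ∑ r, w r ^ 2 := by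
            rw [Finset.mul_sum]
            exact Finset.sum_congr rfl fun r _ => by ring
        _ = 0 := by rw [hF, mul_zero]
    · simp only [Pi.zero_apply, mul_zero, add_zero, Finset.sum_const_zero, Complex.re_sum]
      refine Finset.sum_eq_zero fun r _ => ?_
      simp only [Complex.mul_re, Complex.mul_im, Complex.conj_re, Complex.conj_im,
        Complex.I_re, Complex.I_im]
      ring
    · have hpos : 0 < ∑ r, c r * Complex.normSq (w r) := by
        obtain ⟨r, -, hr⟩ := Finset.exists_ne_zero_of_sum_ne_zero (hρ.trans_ne one_ne_zero)
        exact Finset.sum_pos' (fun i _ => mul_nonneg (hc i).le (Complex.normSq_nonneg _))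
          ⟨r, Finset.mem_univ r,
            mul_pos (hc r) ((Complex.normSq_nonneg _).lt_of_ne' hr)⟩
      simp only [Pi.zero_apply, map_zero, mul_zero, sub_zero, Finset.sum_const_zero, add_zero,
        rotate_form]
      rw [← Finset.mul_sum, ← Complex.ofReal_sum]
      simp only [ne_eq, mul_eq_zero, Complex.I_ne_zero, Complex.ofReal_eq_zero, hpos.ne',
        neg_eq_zero, OfNat.ofNat_ne_zero, or_self, not_false_eq_true]
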